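/- For the ensemble {(1/2, ψ); (1/2, ρ)} on ℂ²⊗ℂ², the infimum of the error probability over all one-way (Alice-to-Bob) two-outcome POVMs equals the infimum over the restricted class of one-way POVMs in which Alice's POVM has the four-element symmetric form { q₀·|φ₀⟩⟨φ₀|, q₀·σ_z|φ₀⟩⟨φ₀|σ_z, q₁·|φ₁⟩⟨φ₁|, q₁·σ_z|φ₁⟩⟨φ₁|σ_z }, where q₀, q₁ ≥ 0, q₀ + q₁ = 1, q₀·cos φ₀ + q₁·cos φ₁ = 0, and |φ⟩ = cos(φ/2)|0⟩ + sin(φ/2)|1⟩. -/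

import Mathlib

open Matrix Kronecker
open scoped ComplexOrder

/-- The rank-one matrix `|ψ⟩⟨ψ|` with `(i,j)`-entry `ψ i * conj (ψ j)`. -/
noncomputable def ketbra {n : Type*} (ψ : n → ℂ) : Matrix n n ℂ :=
  Matrix.vecMulVec ψ (star ψ)

/-- Kronecker product of vectors. -/
noncomputable def vkron {m n : Type*} (a : m → ℂ) (b : n → ℂ) : m × n → ℂ :=
  fun p => a p.1 * b p.2

noncomputable def ket0 : Fin 2 → ℂ := ![1, 0]
noncomputable def ket1 : Fin 2 → ℂ := ![0, 1]
noncomputable def ketP : Fin 2 → ℂ := ![(Real.sqrt 2 : ℂ)⁻¹, (Real.sqrt 2 : ℂ)⁻¹]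
noncomputable def ketM : Fin 2 → ℂ := ![(Real.sqrt 2 : ℂ)⁻¹, -(Real.sqrt 2 : ℂ)⁻¹]

/-- `ψ = |00⟩⟨00|`. -/
noncomputable def ψState : Matrix (Fin 2 × Fin 2) (Fin 2 × Fin 2) ℂ :=
  ketbra (vkron ket0 ket0)

/-- `ρ = (1/2)(|++⟩⟨++| + |--⟩⟨--|)`. -/
noncomputable def ρState : Matrix (Fin 2 × Fin 2) (Fin 2 × Fin 2) ℂ :=
  (1/2 : ℂ) • (ketbra (vkron ketP ketP) + ketbra (vkron ketM ketM))

/-- Error probability of a one-way (Alice-to-Bob) two-outcome POVM `{(A_λ, B_λ)}` for the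
ensemble `{(1/2, ψ); (1/2, ρ)}`. -/
noncomputable def errOneWay {Λ : Type*} [Fintype Λ]
    (A B : Λ → Matrix (Fin 2) (Fin 2) ℂ) : ℝ :=
  (∑ l, ((1/2 : ℂ) * (((A l) ⊗ₖ (1 - B l)) * ψState).trace
      + (1/2 : ℂ) * (((A l) ⊗ₖ (B l)) * ρState).trace)).re

/-- Errors achievable by arbitrary one-way (Alice-to-Bob) two-outcome POVMs. -/
noncomputable def oneWayErrors : Set ℝ :=
  { e | ∃ (n : ℕ) (A B : Fin n → Matrix (Fin 2) (Fin 2) ℂ),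
      (∀ l, (A l).PosSemidef) ∧ (∑ l, A l) = 1 ∧
      (∀ l, (B l).PosSemidef ∧ (1 - B l).PosSemidef) ∧ e = errOneWay A B }

/-- `|φ⟩ = cos(φ/2)|0⟩ + sin(φ/2)|1⟩`. -/
noncomputable def φvec (t : ℝ) : Fin 2 → ℂ :=
  ![(Real.cos (t / 2) : ℂ), (Real.sin (t / 2) : ℂ)]

/-- The Pauli matrix `σ_z = diag(1, −1)`. -/
noncomputable def Zmat : Matrix (Fin 2) (Fin 2) ℂ := Matrix.diagonal ![1, -1]

/-- Alice's four-element symmetric POVM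
`{q₀|φ₀⟩⟨φ₀|, q₀σ_z|φ₀⟩⟨φ₀|σ_z, q₁|φ₁⟩⟨φ₁|, q₁σ_z|φ₁⟩⟨φ₁|σ_z}`. -/
noncomputable def aliceSym (q0 q1 t0 t1 : ℝ) : Fin 4 → Matrix (Fin 2) (Fin 2) ℂ :=
  ![(q0 : ℂ) • ketbra (φvec t0), (q0 : ℂ) • (Zmat * ketbra (φvec t0) * Zmat),
    (q1 : ℂ) • ketbra (φvec t1), (q1 : ℂ) • (Zmat * ketbra (φvec t1) * Zmat)]

/-- Errors achievable by one-way POVMs whose Alice part has the symmetric form. -/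
noncomputable def oneWaySymErrors : Set ℝ :=
  { e | ∃ (q0 q1 t0 t1 : ℝ) (B : Fin 4 → Matrix (Fin 2) (Fin 2) ℂ),
      0 ≤ q0 ∧ 0 ≤ q1 ∧ q0 + q1 = 1 ∧
      q0 * Real.cos t0 + q1 * Real.cos t1 = 0 ∧
      (∀ l, (B l).PosSemidef ∧ (1 - B l).PosSemidef) ∧
      e = errOneWay (aliceSym q0 q1 t0 t1) B }

/-- Off-diagonal sum of a 2×2 matrix (real part), i.e. `tr (M σ_x)`. -/
noncomputable def offd (M : Matrix (Fin 2) (Fin 2) ℂ) : ℝ := (M 0 1 + M 1 0).re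

/-- Single-outcome error in real coordinates. -/
noncomputable def errR (u v y : ℝ) (B : Matrix (Fin 2) (Fin 2) ℂ) : ℝ :=
  1/2 * (u * (1 - (B 0 0).re)) + 1/8 * ((u + v) * ((B 0 0).re + (B 1 1).re) + y * offd B)

lemma psd_facts {M : Matrix (Fin 2) (Fin 2) ℂ} (h : M.PosSemidef) :
    0 ≤ (M 0 0).re ∧ (M 0 0).im = 0 ∧ 0 ≤ (M 1 1).re ∧ (M 1 1).im = 0 ∧
    (M 1 0).re = (M 0 1).re ∧ (M 1 0).im = -(M 0 1).im ∧
    (offd M)^2 ≤ 4 * ((M 0 0).re * (M 1 1).re) := by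
  have h0 := h.diag_nonneg (i := 0)
  have h1 := h.diag_nonneg (i := 1)
  have hd := h.det_nonneg
  have hh := h.isHermitian.apply 1 0
  rw [Matrix.det_fin_two] at hd
  rw [Complex.le_def] at h0 h1 hd
  rw [Complex.ext_iff] at hh
  simp [Complex.mul_re, Complex.mul_im] at h0 h1 hd hh
  obtain ⟨h0a, h0b⟩ := h0
  obtain ⟨h1a, h1b⟩ := h1
  obtain ⟨ha, hb⟩ := hh
  have hd1 := hd.1
  refine ⟨h0a, h0b.symm, h1a, h1b.symm, ha.symm, by linarith, ?_⟩
  have hb' : (M 1 0).im = -(M 0 1).im := by linarith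
  rw [offd, Complex.add_re, ← ha]
  rw [← ha, hb', ← h0b, ← h1b] at hd1
  nlinarith [sq_nonneg (M 0 1).im]

lemma psd_diag {M : Matrix (Fin 2) (Fin 2) ℂ} (h : (1 - M).PosSemidef) : (M 0 0).re ≤ 1 := by
  have := (psd_facts h).1
  simp at this
  exact this

lemma sqrt_two_inv_mul : ((Real.sqrt 2 : ℂ)⁻¹) * (Real.sqrt 2 : ℂ)⁻¹ = 1/2 := by
  rw [← mul_inv, ← Complex.ofReal_mul, Real.mul_self_sqrt (by norm_num)]
  norm_num

lemma trace_psi (A B : Matrix (Fin 2) (Fin 2) ℂ) :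
    ((A ⊗ₖ B) * ψState).trace = A 0 0 * B 0 0 := by
  simp [ψState, ketbra, vkron, ket0, Matrix.trace, Matrix.mul_apply, Fintype.sum_prod_type,
    Fin.sum_univ_two, Matrix.vecMulVec_apply, Matrix.kroneckerMap_apply]

lemma trace_rho (A B : Matrix (Fin 2) (Fin 2) ℂ) :
    ((A ⊗ₖ B) * ρState).trace =
      1/4 * ((A 0 0 + A 1 1) * (B 0 0 + B 1 1) + (A 0 1 + A 1 0) * (B 0 1 + B 1 0)) := by
  have hs := sqrt_two_inv_mul
  simp only [ρState, ketbra, vkron, ketP, ketM, Matrix.trace, Matrix.mul_apply,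
    Fintype.sum_prod_type, Fin.sum_univ_two, Matrix.vecMulVec_apply, Matrix.kroneckerMap_apply,
    Matrix.diag_apply, Matrix.smul_apply, Matrix.add_apply, Pi.star_apply, smul_eq_mul]
  simp only [Matrix.cons_val_zero, Matrix.cons_val_one, star_mul', star_neg, star_inv₀,
    Complex.star_def, Complex.conj_ofReal]
  generalize ((Real.sqrt 2 : ℂ)⁻¹) = r at hs ⊢
  have h4 : r^4 = 1/4 := by
    have : r^4 = (r*r)*(r*r) := by ring
    rw [this, hs]; norm_num
  linear_combination ((A 0 0 + A 1 1) * (B 0 0 + B 1 1) + (A 0 1 + A 1 0) * (B 0 1 + B 1 0)) * h4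

lemma err_eq {n : ℕ} (A B : Fin n → Matrix (Fin 2) (Fin 2) ℂ) (hA : ∀ l, (A l).PosSemidef) :
    errOneWay A B = ∑ l, errR (A l 0 0).re (A l 1 1).re (offd (A l)) (B l) := by
  rw [errOneWay, Complex.re_sum]
  refine Finset.sum_congr rfl fun l _ => ?_
  obtain ⟨_, h0, _, h1, hr, hi, _⟩ := psd_facts (hA l)
  rw [trace_psi, trace_rho]
  have e2 : ((1/2 : ℂ)) = ((1/2 : ℝ) : ℂ) := by norm_num
  have e4 : ((1/4 : ℂ)) = ((1/4 : ℝ) : ℂ) := by norm_num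
  rw [e2, e4]
  simp only [Complex.add_re, Complex.ofReal_re, Complex.ofReal_im, Complex.mul_re, Complex.add_im, h0, h1, hi,
    errR, offd, Matrix.sub_apply, Complex.sub_re, Matrix.one_apply_eq, Complex.one_re]
  ring

lemma errR_nonneg {u v y : ℝ} {B : Matrix (Fin 2) (Fin 2) ℂ} (hu : 0 ≤ u) (hv : 0 ≤ v)
    (hy : y^2 ≤ 4 * (u * v)) (hB : B.PosSemidef) (hB' : (1 - B).PosSemidef) :
    0 ≤ errR u v y B := by
  obtain ⟨b0, _, b1, _, _, _, hb⟩ := psd_facts hB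
  have hB1 := psd_diag hB'
  have k1 : |y| ≤ u + v := abs_le_of_sq_le_sq (by nlinarith [sq_nonneg (u - v)]) (by linarith)
  have k2 : |offd B| ≤ (B 0 0).re + (B 1 1).re :=
    abs_le_of_sq_le_sq (by nlinarith [sq_nonneg ((B 0 0).re - (B 1 1).re)]) (by linarith)
  have k3 : |y * offd B| ≤ (u + v) * ((B 0 0).re + (B 1 1).re) := by
    rw [abs_mul]; exact mul_le_mul k1 k2 (abs_nonneg _) (by linarith)
  have := neg_abs_le (y * offd B)
  have : 0 ≤ u * (1 - (B 0 0).re) := mul_nonneg hu (by linarith)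
  unfold errR
  linarith

lemma oneWay_nonneg {e : ℝ} (he : e ∈ oneWayErrors) : 0 ≤ e := by
  obtain ⟨n, A, B, hA, _, hB, rfl⟩ := he
  rw [err_eq A B hA]
  refine Finset.sum_nonneg fun l _ => ?_
  obtain ⟨h0, _, h1, _, _, _, h⟩ := psd_facts (hA l)
  exact errR_nonneg h0 h1 h (hB l).1 (hB l).2

lemma ketbra_psd (x : Fin 2 → ℂ) : (ketbra x).PosSemidef :=
  Matrix.posSemidef_vecMulVec_self_star x

lemma Z_herm : Zmatᴴ = Zmat := by
  ext i j; fin_cases i <;> fin_cases j <;> simp [Zmat]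

lemma Zconj_psd {M : Matrix (Fin 2) (Fin 2) ℂ} (h : M.PosSemidef) :
    (Zmat * M * Zmat).PosSemidef := by
  have := h.conjTranspose_mul_mul_same Zmat
  rwa [Z_herm] at this

lemma Z_sq : Zmat * Zmat = 1 := by
  ext i j; fin_cases i <;> fin_cases j <;> simp [Zmat]

lemma Zconj_apply (M : Matrix (Fin 2) (Fin 2) ℂ) :
    (Zmat * M * Zmat) 0 0 = M 0 0 ∧ (Zmat * M * Zmat) 1 1 = M 1 1 ∧
    (Zmat * M * Zmat) 0 1 = - M 0 1 ∧ (Zmat * M * Zmat) 1 0 = - M 1 0 := by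
  simp [Zmat]

lemma Zconj_eff {M : Matrix (Fin 2) (Fin 2) ℂ} (h : M.PosSemidef ∧ (1 - M).PosSemidef) :
    (Zmat * M * Zmat).PosSemidef ∧ (1 - Zmat * M * Zmat).PosSemidef := by
  refine ⟨Zconj_psd h.1, ?_⟩
  have := Zconj_psd h.2
  rwa [mul_sub, sub_mul, mul_one, Z_sq] at this

lemma ketphi (t : ℝ) :
    ketbra (φvec t) 0 0 = (((1 + Real.cos t)/2 : ℝ) : ℂ) ∧
    ketbra (φvec t) 1 1 = (((1 - Real.cos t)/2 : ℝ) : ℂ) ∧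
    ketbra (φvec t) 0 1 = ((Real.sin t / 2 : ℝ) : ℂ) ∧
    ketbra (φvec t) 1 0 = ((Real.sin t / 2 : ℝ) : ℂ) := by
  have hc : Real.cos t = 2 * Real.cos (t/2)^2 - 1 := by
    rw [← Real.cos_two_mul]; congr 1; ring
  have hs : Real.sin t = 2 * Real.sin (t/2) * Real.cos (t/2) := by
    rw [← Real.sin_two_mul]; congr 1; ring
  have h1 := Real.sin_sq_add_cos_sq (t/2)
  have key : ∀ a b : ℝ, ((a : ℂ) * star (b : ℂ)) = ((a * b : ℝ) : ℂ) := by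
    intro a b; simp
  simp only [ketbra, φvec, Matrix.vecMulVec_apply, Pi.star_apply, Matrix.cons_val_zero,
    Matrix.cons_val_one, key, Complex.ofReal_inj]
  refine ⟨?_, ?_, ?_, ?_⟩ <;> first | rw [hc] | rw [hs]
  all_goals nlinarith

/-- normalized error `F(t,B)` -/
noncomputable def FF (t : ℝ) (B : Matrix (Fin 2) (Fin 2) ℂ) : ℝ :=
  2 * errR ((1 + Real.cos t)/2) ((1 - Real.cos t)/2) (Real.sin t) B

lemma aliceSym_psd {q0 q1 : ℝ} (t0 t1 : ℝ) (h0 : 0 ≤ q0) (h1 : 0 ≤ q1) (l : Fin 4) :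
    (aliceSym q0 q1 t0 t1 l).PosSemidef := by
  have k0 : (0:ℂ) ≤ (q0 : ℂ) := by exact_mod_cast h0
  have k1 : (0:ℂ) ≤ (q1 : ℂ) := by exact_mod_cast h1
  fin_cases l
  · exact (ketbra_psd _).smul k0
  · exact (Zconj_psd (ketbra_psd _)).smul k0
  · exact (ketbra_psd _).smul k1
  · exact (Zconj_psd (ketbra_psd _)).smul k1

lemma sym_sub : oneWaySymErrors ⊆ oneWayErrors := by
  rintro e ⟨q0, q1, t0, t1, B, h0, h1, hq, hc, hB, rfl⟩
  refine ⟨4, _, B, aliceSym_psd t0 t1 h0 h1, ?_, hB, rfl⟩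
  obtain ⟨a1, a2, a3, a4⟩ := ketphi t0
  obtain ⟨b1, b2, b3, b4⟩ := ketphi t1
  obtain ⟨c1, c2, c3, c4⟩ := Zconj_apply (ketbra (φvec t0))
  obtain ⟨d1, d2, d3, d4⟩ := Zconj_apply (ketbra (φvec t1))
  have hqC : (q0 : ℂ) + q1 = 1 := by exact_mod_cast hq
  have hcC : (q0 : ℂ) * Real.cos t0 + q1 * Real.cos t1 = 0 := by exact_mod_cast hc
  push_cast at hcC
  rw [Fin.sum_univ_four]
  ext i j
  fin_cases i <;> fin_cases j <;>
    simp only [aliceSym, Matrix.add_apply, Fin.zero_eta, Fin.mk_one, Matrix.cons_val,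
      Matrix.smul_apply, smul_eq_mul, a1, a2, a3, a4, b1, b2, b3, b4, c1, c2, c3, c4,
      d1, d2, d3, d4, Matrix.one_apply_eq, ne_eq, zero_ne_one, one_ne_zero, not_false_eq_true,
      Matrix.one_apply_ne] <;> push_cast
  · linear_combination hqC + hcC
  · ring
  · ring
  · linear_combination hqC - hcC

lemma pair_mem {q0 q1 t0 t1 : ℝ} {B0 B1 : Matrix (Fin 2) (Fin 2) ℂ} (h0 : 0 ≤ q0) (h1 : 0 ≤ q1)
    (hq : q0 + q1 = 1) (hc : q0 * Real.cos t0 + q1 * Real.cos t1 = 0)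
    (hB0 : B0.PosSemidef ∧ (1 - B0).PosSemidef) (hB1 : B1.PosSemidef ∧ (1 - B1).PosSemidef) :
    q0 * FF t0 B0 + q1 * FF t1 B1 ∈ oneWaySymErrors := by
  refine ⟨q0, q1, t0, t1, ![B0, Zmat * B0 * Zmat, B1, Zmat * B1 * Zmat], h0, h1, hq, hc, ?_, ?_⟩
  · intro l
    fin_cases l
    · exact hB0
    · exact Zconj_eff hB0
    · exact hB1
    · exact Zconj_eff hB1
  · rw [err_eq _ _ (aliceSym_psd t0 t1 h0 h1), Fin.sum_univ_four]
    obtain ⟨a1, a2, a3, a4⟩ := ketphi t0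
    obtain ⟨b1, b2, b3, b4⟩ := ketphi t1
    obtain ⟨c1, c2, c3, c4⟩ := Zconj_apply (ketbra (φvec t0))
    obtain ⟨d1, d2, d3, d4⟩ := Zconj_apply (ketbra (φvec t1))
    obtain ⟨e1, e2, e3, e4⟩ := Zconj_apply B0
    obtain ⟨f1, f2, f3, f4⟩ := Zconj_apply B1
    simp only [aliceSym, Matrix.cons_val, FF, errR, offd,
      Matrix.smul_apply, smul_eq_mul, a1, a2, a3, a4, b1, b2, b3, b4, c1, c2, c3, c4,
      d1, d2, d3, d4, e1, e2, e3, e4, f1, f2, f3, f4, Complex.add_re, Complex.re_ofReal_mul,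
      Complex.neg_re, Complex.ofReal_re]
    ring

lemma sym_bdd : BddBelow oneWaySymErrors := ⟨0, fun _ he => oneWay_nonneg (sym_sub he)⟩

lemma eff_zero : (0 : Matrix (Fin 2) (Fin 2) ℂ).PosSemidef ∧
    (1 - (0 : Matrix (Fin 2) (Fin 2) ℂ)).PosSemidef := by
  refine ⟨Matrix.PosSemidef.zero, ?_⟩
  rw [sub_zero]; exact Matrix.PosSemidef.one

/-- Supporting line through `(0, c)`. -/
lemma exists_slope : ∃ s : ℝ, ∀ t B, B.PosSemidef ∧ (1 - B).PosSemidef →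
    sInf oneWaySymErrors + s * Real.cos t ≤ FF t B := by
  set c := sInf oneWaySymErrors with hcdef
  let S : Set ℝ := {x | ∃ t B, (B.PosSemidef ∧ (1 - B).PosSemidef) ∧ Real.cos t < 0 ∧
    x = (FF t B - c) / Real.cos t}
  let T : Set ℝ := {x | ∃ t B, (B.PosSemidef ∧ (1 - B).PosSemidef) ∧ 0 < Real.cos t ∧
    x = (FF t B - c) / Real.cos t}
  have hS : S.Nonempty := ⟨_, Real.pi, 0, eff_zero, by simp, rfl⟩
  have hT : T.Nonempty := ⟨_, 0, 0, eff_zero, by simp, rfl⟩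
  obtain ⟨s, hs1, hs2⟩ : ∃ s, s ∈ upperBounds S ∧ s ∈ lowerBounds T := by
    refine ⟨sSup S, ?_, ?_⟩
    all_goals
      have hST : ∀ x ∈ S, ∀ y ∈ T, x ≤ y := by
        rintro x ⟨t, B, hB, ht, rfl⟩ y ⟨t', B', hB', ht', rfl⟩
        have hd : 0 < Real.cos t' - Real.cos t := by linarith
        have := csInf_le sym_bdd (pair_mem (q0 := Real.cos t' / (Real.cos t' - Real.cos t))
          (q1 := -Real.cos t / (Real.cos t' - Real.cos t)) (t0 := t) (t1 := t')
          (div_nonneg ht'.le hd.le) (div_nonneg (by linarith) hd.le)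
          (by field_simp; ring) (by ring) hB hB')
        rw [← hcdef, div_mul_eq_mul_div, div_mul_eq_mul_div, ← add_div, le_div_iff₀ hd] at this
        rw [div_le_iff_of_neg ht, div_mul_eq_mul_div, div_le_iff₀ ht']
        linarith
    · intro x hx
      obtain ⟨y, hy⟩ := hT
      exact le_csSup ⟨y, fun z hz => hST z hz y hy⟩ hx
    · intro y hy
      exact csSup_le hS fun z hz => hST z hz y hy
  refine ⟨s, fun t B hB => ?_⟩
  rcases lt_trichotomy (Real.cos t) 0 with h | h | h
  · have := hs1 ⟨t, B, hB, h, rfl⟩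
    rw [div_le_iff_of_neg h] at this
    linarith
  · have := csInf_le sym_bdd (pair_mem (q0 := 1) (q1 := 0) (t0 := t) (t1 := t)
      (by norm_num) le_rfl (by norm_num) (by rw [h]; ring) hB hB)
    rw [h]; linarith
  · have := hs2 ⟨t, B, hB, h, rfl⟩
    rw [le_div_iff₀ h] at this
    linarith

lemma errR_lower {c s : ℝ} {B : Matrix (Fin 2) (Fin 2) ℂ}
    (hF : ∀ t, c + s * Real.cos t ≤ FF t B) {u v y : ℝ} (hu : 0 ≤ u) (hv : 0 ≤ v)
    (hy : y^2 ≤ 4 * (u * v)) : 1/2 * (c * (u + v) + s * (u - v)) ≤ errR u v y B := by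
  rcases (add_nonneg hu hv).eq_or_lt with ha | ha
  · have hu0 : u = 0 := by linarith
    have hv0 : v = 0 := by linarith
    subst hu0 hv0
    have : y = 0 := by nlinarith
    subst this
    simp [errR]
  · set a := u + v with had
    set z := (u - v) / a with hz
    have hza : z * a = u - v := by rw [hz]; field_simp
    have hz1 : -1 ≤ z := by rw [hz, le_div_iff₀ ha]; linarith
    have hz2 : z ≤ 1 := by rw [hz, div_le_iff₀ ha]; linarith
    have h1 := hF (Real.arccos z)
    have h2 := hF (-Real.arccos z)
    rw [Real.cos_neg] at h2
    simp only [FF, Real.cos_neg, Real.sin_neg, Real.cos_arccos hz1 hz2, errR] at h1 h2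
    have hsn : 0 ≤ Real.sin (Real.arccos z) :=
      Real.sin_nonneg_of_nonneg_of_le_pi (Real.arccos_nonneg z) (Real.arccos_le_pi z)
    have hsq := Real.sin_sq_add_cos_sq (Real.arccos z)
    rw [Real.cos_arccos hz1 hz2] at hsq
    set w := Real.sin (Real.arccos z)
    have hyw : |y| ≤ a * w := by
      apply abs_le_of_sq_le_sq _ (mul_nonneg ha.le hsn)
      have : (a * w)^2 = a^2 - (z*a)^2 := by linear_combination a^2 * hsq
      rw [this, hza, had]; nlinarith
    have hm : -(a * w * |offd B|) ≤ y * offd B := by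
      have := neg_abs_le (y * offd B)
      rw [abs_mul] at this
      nlinarith [mul_le_mul_of_nonneg_right hyw (abs_nonneg (offd B))]
    have hu' : u = a * ((1 + z)/2) := by linarith
    have h3 : c + s * z ≤ 2 * (1/2 * ((1+z)/2 * (1 - (B 0 0).re)) +
        1/8 * (((B 0 0).re + (B 1 1).re) - w * |offd B|)) := by
      rcases abs_cases (offd B) with ⟨h, _⟩ | ⟨h, _⟩ <;> rw [h] <;> linarith
    have h4 := mul_le_mul_of_nonneg_left h3 ha.le
    have h5 : c * a + s * (u - v) = a * (c + s * z) := by rw [← hza]; ring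
    unfold errR
    rw [h5, ← had]
    have h6 : u * (1 - (B 0 0).re) = a * ((1 + z)/2) * (1 - (B 0 0).re) := by rw [← hu']
    rw [h6]
    linarith

theorem stmt_19 : sInf oneWayErrors = sInf oneWaySymErrors := by
  have hne : oneWaySymErrors.Nonempty :=
    ⟨_, pair_mem (q0 := 1) (q1 := 0) (t0 := Real.pi/2) (t1 := 0) (by norm_num) le_rfl
      (by norm_num) (by simp) eff_zero eff_zero⟩
  apply le_antisymm
  · exact csInf_le_csInf ⟨0, fun _ he => oneWay_nonneg he⟩ hne sym_sub
  · refine le_csInf (hne.mono sym_sub) ?_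
    rintro e ⟨n, A, B, hA, hsum, hB, rfl⟩
    obtain ⟨s, hs⟩ := exists_slope
    set c := sInf oneWaySymErrors
    rw [err_eq A B hA]
    have h00 : ∑ l, (A l 0 0).re = 1 := by
      rw [← Complex.re_sum, ← Matrix.sum_apply, hsum]; simp
    have h11 : ∑ l, (A l 1 1).re = 1 := by
      rw [← Complex.re_sum, ← Matrix.sum_apply, hsum]; simp
    have hle := Finset.sum_le_sum (s := Finset.univ) fun l (_ : l ∈ Finset.univ) =>
      errR_lower (fun t => hs t (B l) (hB l)) (psd_facts (hA l)).1 (psd_facts (hA l)).2.2.1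
        (psd_facts (hA l)).2.2.2.2.2.2
    refine le_trans (le_of_eq ?_) hle
    rw [← Finset.mul_sum, Finset.sum_add_distrib, ← Finset.mul_sum, ← Finset.mul_sum,
      Finset.sum_add_distrib, Finset.sum_sub_distrib, h00, h11]
    ring
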